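/- For any invertible n×n matrices φ, ψ over A and all τ₀, τ₁, τ₂ ∈ Der: p₃(φ)(τ₀,τ₁,τ₂) + p₃(ψ)(τ₀,τ₁,τ₂) − p₃(φ·ψ)(τ₀,τ₁,τ₂) = τ₀(P₂(φ,ψ)(τ₁,τ₂)) − τ₁(P₂(φ,ψ)(τ₀,τ₂)) + τ₂(P₂(φ,ψ)(τ₀,τ₁)) − P₂(φ,ψ)(⁅τ₀,τ₁⁆,τ₂) + P₂(φ,ψ)(⁅τ₀,τ₂⁆,τ₁) − P₂(φ,ψ)(⁅τ₁,τ₂⁆,τ₀). (Section 3.5: the identity d_Čech p₃(φ) = d_DR p₂(φ), where the de Rham differential of a 2-form on derivations is given by the Chevalley–Eilenberg formula.) -/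

import Mathlib

noncomputable section

variable (k A : Type*) [Field k] [CharZero k] [CommRing A] [Algebra k A]

/-- Entrywise application of a derivation to a matrix. -/
def dmat {n : ℕ} (τ : Derivation k A A) (φ : Matrix (Fin n) (Fin n) A) :
    Matrix (Fin n) (Fin n) A :=
  Matrix.of fun p q => τ (φ p q)

/-- One half, as an element of `A`. -/
def half : A := algebraMap k A 2⁻¹

/-- `P₂(φ,ψ)(τ,σ) := ½[tr(ψ⁻¹φ⁻¹τ(φ)σ(ψ)) − tr(ψ⁻¹φ⁻¹σ(φ)τ(ψ))]`,
the 2-form `½ tr{ψ⁻¹φ⁻¹ dφ dψ}` evaluated on `(τ,σ)`. -/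
def P2 {n : ℕ} (φ ψ : Matrix (Fin n) (Fin n) A) (τ σ : Derivation k A A) : A :=
  half k A * (Matrix.trace (ψ⁻¹ * φ⁻¹ * dmat k A τ φ * dmat k A σ ψ)
    - Matrix.trace (ψ⁻¹ * φ⁻¹ * dmat k A σ φ * dmat k A τ ψ))

/-- `p₃(φ)(τ₁,τ₂,τ₃) := (1/6)·Σ_{π∈S₃} sgn(π)·tr(N_{π(1)} N_{π(2)} N_{π(3)})`
with `N_i = φ⁻¹·τ_i(φ)`; the 3-form `(1/6)tr{(φ⁻¹dφ)³}` evaluated on `(τ₁,τ₂,τ₃)`. -/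
def p3 {n : ℕ} (φ : Matrix (Fin n) (Fin n) A) (τ₁ τ₂ τ₃ : Derivation k A A) : A :=
  algebraMap k A 6⁻¹ *
    ∑ π : Equiv.Perm (Fin 3), (Equiv.Perm.sign π : ℤ) •
      Matrix.trace ((φ⁻¹ * dmat k A (![τ₁, τ₂, τ₃] (π 0)) φ) *
        (φ⁻¹ * dmat k A (![τ₁, τ₂, τ₃] (π 1)) φ) *
        (φ⁻¹ * dmat k A (![τ₁, τ₂, τ₃] (π 2)) φ))

/-- The cochain `p₂(φ,g)` of Section 3.5 (with `g = g_i`, `h = g_j`), evaluated on `(τ,σ)`. -/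
def Qc {n : ℕ} (φ g h : Matrix (Fin n) (Fin n) A) (τ σ : Derivation k A A) : A :=
  half k A * (Matrix.trace (φ⁻¹ * g⁻¹ * dmat k A τ g * φ * h⁻¹ * dmat k A σ h)
    - Matrix.trace (φ⁻¹ * g⁻¹ * dmat k A σ g * φ * h⁻¹ * dmat k A τ h)
    + Matrix.trace (φ⁻¹ * dmat k A τ φ * h⁻¹ * dmat k A σ h)
    - Matrix.trace (φ⁻¹ * dmat k A σ φ * h⁻¹ * dmat k A τ h)
    - Matrix.trace (g⁻¹ * dmat k A τ g * dmat k A σ φ * φ⁻¹)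
    + Matrix.trace (g⁻¹ * dmat k A σ g * dmat k A τ φ * φ⁻¹))

theorem Equiv.Perm.sum_fin_three {M : Type*} [AddCommMonoid M]
    (f : Equiv.Perm (Fin 3) → M) :
    ∑ π, f π = f 1 + f (Equiv.swap 0 1) + f (Equiv.swap 0 2) + f (Equiv.swap 1 2)
      + f (Equiv.swap 0 1 * Equiv.swap 1 2) + f (Equiv.swap 1 2 * Equiv.swap 0 1) := by
  have h : (Finset.univ : Finset (Equiv.Perm (Fin 3))) =
      {1, Equiv.swap 0 1, Equiv.swap 0 2, Equiv.swap 1 2,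
        Equiv.swap 0 1 * Equiv.swap 1 2, Equiv.swap 1 2 * Equiv.swap 0 1} := by
    decide
  rw [h, Finset.sum_insert (by decide), Finset.sum_insert (by decide),
    Finset.sum_insert (by decide), Finset.sum_insert (by decide),
    Finset.sum_insert (by decide), Finset.sum_singleton]
  simp only [add_assoc]

section MatrixDerivation

variable {n : ℕ}

omit [CharZero k] in
@[simp]
theorem dmat_apply (τ : Derivation k A A) (φ : Matrix (Fin n) (Fin n) A) (i j : Fin n) :
    dmat k A τ φ i j = τ (φ i j) := rfl

omit [CharZero k] in
theorem dmat_mul (τ : Derivation k A A) (φ ψ : Matrix (Fin n) (Fin n) A) :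
    dmat k A τ (φ * ψ) = dmat k A τ φ * ψ + φ * dmat k A τ ψ := by
  ext i j
  simp only [dmat_apply, Matrix.mul_apply, Matrix.add_apply, map_sum, Derivation.leibniz,
    smul_eq_mul, ← Finset.sum_add_distrib]
  exact Finset.sum_congr rfl fun _ _ => by ring

omit [CharZero k] in
theorem dmat_one (τ : Derivation k A A) :
    dmat k A τ (1 : Matrix (Fin n) (Fin n) A) = 0 := by
  ext i j
  by_cases h : i = j <;> simp [h]

omit [CharZero k] in
theorem dmat_lie (τ σ : Derivation k A A) (φ : Matrix (Fin n) (Fin n) A) :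
    dmat k A ⁅τ, σ⁆ φ = dmat k A τ (dmat k A σ φ) - dmat k A σ (dmat k A τ φ) := by
  ext i j
  simp [Derivation.commutator_apply]

omit [CharZero k] in
theorem derivation_trace (τ : Derivation k A A) (φ : Matrix (Fin n) (Fin n) A) :
    τ φ.trace = (dmat k A τ φ).trace := by
  simp [Matrix.trace]

omit [CharZero k] in
theorem derivation_half_mul (τ : Derivation k A A) (a : A) :
    τ (half k A * a) = half k A * τ a := by
  simp [half]

omit [CharZero k] in
theorem dmat_inv (τ : Derivation k A A) {φ : Matrix (Fin n) (Fin n) A} (hφ : IsUnit φ) :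
    dmat k A τ φ⁻¹ = -(φ⁻¹ * dmat k A τ φ * φ⁻¹) := by
  have hdet := (Matrix.isUnit_iff_isUnit_det φ).1 hφ
  have h := dmat_mul k A τ φ⁻¹ φ
  rw [Matrix.nonsing_inv_mul φ hdet, dmat_one] at h
  have h' := congrArg (· * φ⁻¹) h
  simp only [zero_mul, add_mul, Matrix.mul_nonsing_inv_cancel_right _ _ hdet] at h'
  exact eq_neg_of_add_eq_zero_left h'.symm

omit [CharZero k] in
/-- The Maurer–Cartan equation for the left logarithmic derivative. -/
theorem inv_mul_dmat_lie (τ σ : Derivation k A A) {φ : Matrix (Fin n) (Fin n) A}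
    (hφ : IsUnit φ) :
    φ⁻¹ * dmat k A ⁅τ, σ⁆ φ =
      dmat k A τ (φ⁻¹ * dmat k A σ φ) - dmat k A σ (φ⁻¹ * dmat k A τ φ)
        + φ⁻¹ * dmat k A τ φ * (φ⁻¹ * dmat k A σ φ)
        - φ⁻¹ * dmat k A σ φ * (φ⁻¹ * dmat k A τ φ) := by
  rw [dmat_lie, dmat_mul, dmat_mul, dmat_inv k A τ hφ, dmat_inv k A σ hφ]
  noncomm_ring

omit [CharZero k] in
/-- The Maurer–Cartan equation for the right logarithmic derivative. -/
theorem dmat_lie_mul_inv (τ σ : Derivation k A A) {φ : Matrix (Fin n) (Fin n) A}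
    (hφ : IsUnit φ) :
    dmat k A ⁅τ, σ⁆ φ * φ⁻¹ =
      dmat k A τ (dmat k A σ φ * φ⁻¹) - dmat k A σ (dmat k A τ φ * φ⁻¹)
        + dmat k A σ φ * φ⁻¹ * (dmat k A τ φ * φ⁻¹)
        - dmat k A τ φ * φ⁻¹ * (dmat k A σ φ * φ⁻¹) := by
  rw [dmat_lie, dmat_mul, dmat_mul, dmat_inv k A τ hφ, dmat_inv k A σ hφ]
  noncomm_ring

omit [CharZero k] in
/-- The left logarithmic derivative of a product, up to conjugation. -/
theorem inv_mul_dmat_mul (τ : Derivation k A A) {φ ψ : Matrix (Fin n) (Fin n) A}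
    (hφ : IsUnit φ) (hψ : IsUnit ψ) :
    (φ * ψ)⁻¹ * dmat k A τ (φ * ψ) =
      ψ⁻¹ * ((φ⁻¹ * dmat k A τ φ + dmat k A τ ψ * ψ⁻¹) * ψ) := by
  have hφ' := (Matrix.isUnit_iff_isUnit_det φ).1 hφ
  have hψ' := (Matrix.isUnit_iff_isUnit_det ψ).1 hψ
  simp only [Matrix.mul_inv_rev, dmat_mul, mul_add, add_mul, mul_assoc,
    Matrix.nonsing_inv_mul_cancel_left _ _ hφ', Matrix.nonsing_inv_mul _ hψ', mul_one]

theorem trace_conj_mul_mul {ψ : Matrix (Fin n) (Fin n) A} (hψ : IsUnit ψ)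
    (X Y Z : Matrix (Fin n) (Fin n) A) :
    (ψ⁻¹ * (X * ψ) * (ψ⁻¹ * (Y * ψ)) * (ψ⁻¹ * (Z * ψ))).trace = (X * Y * Z).trace := by
  have hψ' := (Matrix.isUnit_iff_isUnit_det ψ).1 hψ
  simp only [mul_assoc, Matrix.mul_nonsing_inv_cancel_left _ _ hψ']
  rw [Matrix.trace_mul_comm]
  simp only [mul_assoc, Matrix.mul_nonsing_inv _ hψ', mul_one]

/-- By cyclicity of the trace, the six terms of `p3` collapse to two. -/
theorem p3_eq (φ : Matrix (Fin n) (Fin n) A) (τ₁ τ₂ τ₃ : Derivation k A A) :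
    p3 k A φ τ₁ τ₂ τ₃ = half k A *
      ((φ⁻¹ * dmat k A τ₁ φ * (φ⁻¹ * dmat k A τ₂ φ) * (φ⁻¹ * dmat k A τ₃ φ)).trace
        - (φ⁻¹ * dmat k A τ₁ φ * (φ⁻¹ * dmat k A τ₃ φ) * (φ⁻¹ * dmat k A τ₂ φ)).trace) := by
  have hsix : half k A = algebraMap k A 6⁻¹ * 3 := by
    rw [half, ← map_ofNat (algebraMap k A) 3, ← map_mul]
    norm_num
  rw [p3, hsix, mul_assoc, Equiv.Perm.sum_fin_three]
  congr 1
  have h02 : (Equiv.swap 0 2 : Equiv.Perm (Fin 3)) 1 = 1 := by decide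
  have h01 : (Equiv.swap 0 1 : Equiv.Perm (Fin 3)) 2 = 2 := by decide
  have h12 : (Equiv.swap 1 2 : Equiv.Perm (Fin 3)) 0 = 0 := by decide
  generalize hX : φ⁻¹ * dmat k A τ₁ φ = X
  generalize hY : φ⁻¹ * dmat k A τ₂ φ = Y
  generalize hZ : φ⁻¹ * dmat k A τ₃ φ = Z
  simp [hX, hY, hZ, h01, h02, h12]
  linear_combination -Matrix.trace_mul_cycle Y X Z - 2 * Matrix.trace_mul_cycle Z Y X
    + Matrix.trace_mul_cycle Z X Y + 2 * Matrix.trace_mul_cycle Y Z X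

omit [CharZero k] in
/-- `P2` in terms of the left logarithmic derivative of `φ` and the right one of `ψ`. -/
theorem P2_eq (φ ψ : Matrix (Fin n) (Fin n) A) (τ σ : Derivation k A A) :
    P2 k A φ ψ τ σ = half k A *
      ((φ⁻¹ * dmat k A τ φ * (dmat k A σ ψ * ψ⁻¹)).trace
        - (φ⁻¹ * dmat k A σ φ * (dmat k A τ ψ * ψ⁻¹)).trace) := by
  have h (X Y : Matrix (Fin n) (Fin n) A) :
      (ψ⁻¹ * φ⁻¹ * X * Y).trace = (φ⁻¹ * X * (Y * ψ⁻¹)).trace := by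
    rw [mul_assoc, mul_assoc, Matrix.trace_mul_comm]
    simp only [mul_assoc]
  rw [P2, h, h]

end MatrixDerivation

/-- Section 3.5: `d_Čech p₃(φ) = d_DR p₂(φ)`, the de Rham differential of the 2-form
given by the Chevalley–Eilenberg formula. -/
theorem cech_p3_eq_dR_P2 {n : ℕ} (hn : 0 < n)
    (φ ψ : Matrix (Fin n) (Fin n) A) (hφ : IsUnit φ) (hψ : IsUnit ψ)
    (τ₀ τ₁ τ₂ : Derivation k A A) :
    p3 k A φ τ₀ τ₁ τ₂ + p3 k A ψ τ₀ τ₁ τ₂ - p3 k A (φ * ψ) τ₀ τ₁ τ₂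
      = τ₀ (P2 k A φ ψ τ₁ τ₂) - τ₁ (P2 k A φ ψ τ₀ τ₂) + τ₂ (P2 k A φ ψ τ₀ τ₁)
        - P2 k A φ ψ ⁅τ₀, τ₁⁆ τ₂ + P2 k A φ ψ ⁅τ₀, τ₂⁆ τ₁ - P2 k A φ ψ ⁅τ₁, τ₂⁆ τ₀ := by
  have hψ' := (Matrix.isUnit_iff_isUnit_det ψ).1 hψ
  have hconj (τ : Derivation k A A) :
      ψ⁻¹ * dmat k A τ ψ = ψ⁻¹ * (dmat k A τ ψ * ψ⁻¹ * ψ) := by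
    rw [Matrix.nonsing_inv_mul_cancel_right _ _ hψ']
  simp only [p3_eq, P2_eq, inv_mul_dmat_mul k A _ hφ hψ, hconj, trace_conj_mul_mul A hψ,
    derivation_half_mul, map_sub, derivation_trace, inv_mul_dmat_lie k A _ _ hφ,
    dmat_lie_mul_inv k A _ _ hψ]
  obtain ⟨a, ha⟩ : ∃ a : Derivation k A A → Matrix (Fin n) (Fin n) A,
      ∀ τ, φ⁻¹ * dmat k A τ φ = a τ := ⟨_, fun _ => rfl⟩
  obtain ⟨b, hb⟩ : ∃ b : Derivation k A A → Matrix (Fin n) (Fin n) A,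
      ∀ τ, dmat k A τ ψ * ψ⁻¹ = b τ := ⟨_, fun _ => rfl⟩
  have hbaa (τ σ ρ) : (b τ * a σ * a ρ).trace = (a σ * a ρ * b τ).trace :=
    (Matrix.trace_mul_cycle (a σ) (a ρ) (b τ)).symm
  have haba (τ σ ρ) : (a τ * b σ * a ρ).trace = (a ρ * a τ * b σ).trace :=
    Matrix.trace_mul_cycle (a τ) (b σ) (a ρ)
  have hbba (τ σ ρ) : (b τ * b σ * a ρ).trace = (a ρ * b τ * b σ).trace :=
    Matrix.trace_mul_cycle (b τ) (b σ) (a ρ)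
  have hbab (τ σ ρ) : (b τ * a σ * b ρ).trace = (a σ * b ρ * b τ).trace :=
    (Matrix.trace_mul_cycle (a σ) (b ρ) (b τ)).symm
  simp only [ha, hb, dmat_mul, mul_add, add_mul, mul_sub, sub_mul, Matrix.trace_add,
    Matrix.trace_sub, ← mul_assoc, hbaa, haba, hbba, hbab]
  ring
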